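/- (Convexity of SlideVaR on the risk-tail region.) Let X and Y be integrable random variables with S(U_β^φ(X)) = 1 and S(U_β^φ(Y)) = 1, and let λ ∈ [0,1]. Then SlideVaR_{α,β}^φ(λX + (1−λ)Y) ≤ λ·SlideVaR_{α,β}^φ(X) + (1−λ)·SlideVaR_{α,β}^φ(Y). -/

import Mathlib

open MeasureTheory

/-- Quantile function `F_X^{-1}(p) = inf {x : F_X(x) >= p}` of the loss `X` under `P`. -/
noncomputable def quantile {Ω : Type*} [MeasurableSpace Ω] (P : Measure Ω)
    (X : Ω → ℝ) (p : ℝ) : ℝ :=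
  sInf {x : ℝ | p ≤ (P {ω | X ω ≤ x}).toReal}

/-- Tail thickness `U_β^φ(X) = ∫_0^1 F_X^{-1}(p) φ_β(p) dp`. -/
noncomputable def tailThickness {Ω : Type*} [MeasurableSpace Ω] (P : Measure Ω)
    (φ : ℝ → ℝ) (X : Ω → ℝ) : ℝ :=
  ∫ p in (0:ℝ)..1, quantile P X p * φ p

/-- Value at risk `VaR_α(X) = F_X^{-1}(α)`. -/
noncomputable def VaR {Ω : Type*} [MeasurableSpace Ω] (P : Measure Ω)
    (α : ℝ) (X : Ω → ℝ) : ℝ :=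
  quantile P X α

/-- Conditional value at risk `CVaR_α(X) = (1/(1-α)) ∫_α^1 F_X^{-1}(p) dp`. -/
noncomputable def CVaR {Ω : Type*} [MeasurableSpace Ω] (P : Measure Ω)
    (α : ℝ) (X : Ω → ℝ) : ℝ :=
  (1 / (1 - α)) * ∫ p in α..1, quantile P X p

/-- `SlideVaR_{α,β}^φ(X) = S(U_β^φ(X))·CVaR_α(X) + (1 - S(U_β^φ(X)))·VaR_β(X)`. -/
noncomputable def SlideVaR {Ω : Type*} [MeasurableSpace Ω] (P : Measure Ω)
    (α β : ℝ) (φ S : ℝ → ℝ) (X : Ω → ℝ) : ℝ :=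
  S (tailThickness P φ X) * CVaR P α X
    + (1 - S (tailThickness P φ X)) * VaR P β X

open Set Filter Topology ProbabilityTheory

section Quantile

variable {Ω : Type*} [MeasurableSpace Ω] {P : Measure Ω} [IsProbabilityMeasure P] {X : Ω → ℝ}

/-- Galois connection between the quantile function and the cumulative distribution function. -/
lemma quantile_le_iff (hX : AEMeasurable X P) {p : ℝ} (hp : p ∈ Ioo (0 : ℝ) 1) (x : ℝ) :
    quantile P X p ≤ x ↔ p ≤ cdf (P.map X) x := by
  have : IsProbabilityMeasure (P.map X) := Measure.isProbabilityMeasure_map hX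
  have hq : quantile P X p = sInf {x : ℝ | p ≤ cdf (P.map X) x} := by
    simp only [quantile, cdf_eq_real, measureReal_def,
      Measure.map_apply_of_aemeasurable hX measurableSet_Iic]
    rfl
  have hne : {x : ℝ | p ≤ cdf (P.map X) x}.Nonempty :=
    ((tendsto_cdf_atTop (P.map X)).eventually_const_le hp.2).exists
  have hbdd : BddBelow {x : ℝ | p ≤ cdf (P.map X) x} := by
    obtain ⟨b, hb⟩ := ((tendsto_cdf_atBot (P.map X)).eventually_lt_const hp.1).exists
    refine ⟨b, fun x hx => ?_⟩
    by_contra! hxb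
    exact absurd (hx.trans (monotone_cdf (P.map X) hxb.le)) hb.not_ge
  rw [hq]
  refine ⟨fun h => ?_, fun h => csInf_le hbdd h⟩
  have hlim : Tendsto (cdf (P.map X)) (𝓝[>] x) (𝓝 (cdf (P.map X) x)) :=
    ((cdf (P.map X)).right_continuous x).mono_left (nhdsWithin_mono x Ioi_subset_Ici_self)
  refine ge_of_tendsto hlim ?_
  filter_upwards [self_mem_nhdsWithin] with y hy
  obtain ⟨a, ha, hay⟩ := exists_lt_of_csInf_lt hne (h.trans_lt hy)
  exact le_trans ha (monotone_cdf (P.map X) hay.le)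

lemma monotoneOn_quantile (hX : AEMeasurable X P) : MonotoneOn (quantile P X) (Ioo 0 1) :=
  fun _ hp _ hq hpq => (quantile_le_iff hX hp _).2 (hpq.trans ((quantile_le_iff hX hq _).1 le_rfl))

lemma aemeasurable_quantile (hX : AEMeasurable X P) :
    AEMeasurable (quantile P X) (volume.restrict (Ioo 0 1)) :=
  aemeasurable_restrict_of_monotoneOn measurableSet_Ioo (monotoneOn_quantile hX)

/-- The quantile function pushes the uniform law on the unit interval to the law of the loss. -/
lemma map_quantile (hX : AEMeasurable X P) :
    (volume.restrict (Ioo (0 : ℝ) 1)).map (quantile P X) = P.map X := by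
  have : IsProbabilityMeasure (P.map X) := Measure.isProbabilityMeasure_map hX
  have : IsFiniteMeasure (volume.restrict (Ioo (0 : ℝ) 1)) := ⟨by simp⟩
  refine Measure.ext_of_Iic _ _ fun x => ?_
  have hset : quantile P X ⁻¹' Iic x =ᵐ[volume.restrict (Ioo (0 : ℝ) 1)]
      Iic (cdf (P.map X) x) := by
    filter_upwards [ae_restrict_mem measurableSet_Ioo] with p hp
    exact propext (quantile_le_iff hX hp x)
  rw [Measure.map_apply_of_aemeasurable (aemeasurable_quantile hX) measurableSet_Iic,
    measure_congr hset, Measure.restrict_congr_set Ioo_ae_eq_Ioc,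
    Measure.restrict_apply measurableSet_Iic, inter_comm, Ioc_inter_Iic, Real.volume_Ioc,
    min_eq_right (cdf_le_one _ x), sub_zero, ofReal_cdf]

lemma integral_comp_quantile (hX : AEMeasurable X P) {f : ℝ → ℝ} (hf : Measurable f) :
    ∫ p in Ioo (0 : ℝ) 1, f (quantile P X p) = ∫ ω, f (X ω) ∂P := by
  rw [← integral_map (aemeasurable_quantile hX) hf.aestronglyMeasurable, map_quantile hX,
    integral_map hX hf.aestronglyMeasurable]

lemma integrableOn_quantile (hX : Integrable X P) : IntegrableOn (quantile P X) (Ioo 0 1) := by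
  have h : Integrable id (P.map X) :=
    (integrable_map_measure measurable_id.aestronglyMeasurable hX.aemeasurable).2 hX
  rw [← map_quantile hX.aemeasurable] at h
  exact (integrable_map_measure measurable_id.aestronglyMeasurable
    (aemeasurable_quantile hX.aemeasurable)).1 h

variable {α : ℝ}

lemma Ioo_subset_Ioo_zero_one (h0 : 0 < α) : Ioo α 1 ⊆ Ioo (0 : ℝ) 1 := Ioo_subset_Ioo_left h0.le

/-- Shifting the loss by a constant in the tail integral of the conditional value at risk. -/
lemma setIntegral_quantile_sub (h0 : 0 < α) (h1 : α < 1) (hX : Integrable X P) (c : ℝ) :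
    ∫ p in Ioo α 1, (quantile P X p - c) = (1 - α) * (CVaR P α X - c) := by
  rw [integral_sub ((integrableOn_quantile hX).mono_set (Ioo_subset_Ioo_zero_one h0))
    (by simp), CVaR, intervalIntegral.integral_of_le h1.le, integral_Ioc_eq_integral_Ioo]
  have : (1 - α) ≠ 0 := by linarith
  simp [h1.le]
  field_simp

/-- The Rockafellar–Uryasev upper bound for the conditional value at risk. -/
lemma CVaR_le_integral_max (h0 : 0 < α) (h1 : α < 1) (hX : Integrable X P) (c : ℝ) :
    (1 - α) * (CVaR P α X - c) ≤ ∫ ω, max (X ω - c) 0 ∂P := by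
  have hsub := Ioo_subset_Ioo_zero_one h0
  have hint : IntegrableOn (fun p => quantile P X p - c) (Ioo 0 1) :=
    (integrableOn_quantile hX).sub (by simp)
  rw [← setIntegral_quantile_sub h0 h1 hX,
    ← integral_comp_quantile hX.aemeasurable (f := fun x => max (x - c) 0) (by fun_prop)]
  calc ∫ p in Ioo α 1, (quantile P X p - c)
      ≤ ∫ p in Ioo α 1, max (quantile P X p - c) 0 :=
        integral_mono (hint.mono_set hsub) (IntegrableOn.mono_set hint.pos_part hsub)
          fun p => le_max_left _ _
    _ ≤ ∫ p in Ioo 0 1, max (quantile P X p - c) 0 :=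
        setIntegral_mono_set hint.pos_part (ae_of_all _ fun p => le_max_right _ _)
          hsub.eventuallyLE

/-- The Rockafellar–Uryasev bound is attained at the value at risk. -/
lemma integral_max_sub_VaR (h0 : 0 < α) (h1 : α < 1) (hX : Integrable X P) :
    ∫ ω, max (X ω - VaR P α X) 0 ∂P = (1 - α) * (CVaR P α X - VaR P α X) := by
  have hmono := monotoneOn_quantile hX.aemeasurable
  have hα : α ∈ Ioo (0 : ℝ) 1 := ⟨h0, h1⟩
  rw [← setIntegral_quantile_sub h0 h1 hX, ← integral_comp_quantile hX.aemeasurable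
      (f := fun x => max (x - VaR P α X) 0) (by fun_prop)]
  refine (setIntegral_eq_of_subset_of_forall_sdiff_eq_zero measurableSet_Ioo
    (Ioo_subset_Ioo_zero_one h0) ?_).trans ?_
  · rintro p ⟨hp, hpα⟩
    have hle : p ≤ α := by
      by_contra! h
      exact hpα ⟨h, hp.2⟩
    exact max_eq_right (sub_nonpos.2 (hmono hp hα hle))
  · refine setIntegral_congr_fun measurableSet_Ioo fun p hp => ?_
    exact max_eq_left (sub_nonneg.2 (hmono hα (Ioo_subset_Ioo_zero_one h0 hp) hp.1.le))

lemma VaR_le_CVaR (h0 : 0 < α) (h1 : α < 1) (hX : Integrable X P) :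
    VaR P α X ≤ CVaR P α X := by
  have h : 0 ≤ (1 - α) * (CVaR P α X - VaR P α X) := by
    rw [← integral_max_sub_VaR h0 h1 hX]
    exact integral_nonneg fun ω => le_max_right _ _
  exact sub_nonneg.1 (nonneg_of_mul_nonneg_right h (sub_pos.2 h1))

/-- The conditional value at risk is convex. -/
lemma CVaR_convex (h0 : 0 < α) (h1 : α < 1) (hX : Integrable X P) {Y : Ω → ℝ}
    (hY : Integrable Y P) {l : ℝ} (hl : l ∈ Icc (0 : ℝ) 1) :
    CVaR P α (fun ω => l * X ω + (1 - l) * Y ω) ≤ l * CVaR P α X + (1 - l) * CVaR P α Y := by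
  set a := VaR P α X with ha
  set b := VaR P α Y with hb
  have hXa : Integrable (fun ω => max (X ω - a) 0) P := (hX.sub (integrable_const a)).pos_part
  have hYb : Integrable (fun ω => max (Y ω - b) 0) P := (hY.sub (integrable_const b)).pos_part
  have hZ : Integrable (fun ω => l * X ω + (1 - l) * Y ω) P :=
    (hX.const_mul l).add (hY.const_mul (1 - l))
  have hl' : 0 ≤ 1 - l := sub_nonneg.2 hl.2
  have key : ∫ ω, max (l * X ω + (1 - l) * Y ω - (l * a + (1 - l) * b)) 0 ∂P
      ≤ l * ∫ ω, max (X ω - a) 0 ∂P + (1 - l) * ∫ ω, max (Y ω - b) 0 ∂P := by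
    rw [← integral_const_mul, ← integral_const_mul,
      ← integral_add (hXa.const_mul l) (hYb.const_mul (1 - l))]
    refine integral_mono (hZ.sub (integrable_const _)).pos_part
      ((hXa.const_mul l).add (hYb.const_mul (1 - l))) fun ω => max_le ?_ ?_
    · have hx := mul_le_mul_of_nonneg_left (le_max_left (X ω - a) 0) hl.1
      have hy := mul_le_mul_of_nonneg_left (le_max_left (Y ω - b) 0) hl'
      linarith
    · exact add_nonneg (mul_nonneg hl.1 (le_max_right _ _)) (mul_nonneg hl' (le_max_right _ _))
  have h := (CVaR_le_integral_max h0 h1 hZ (l * a + (1 - l) * b)).trans key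
  rw [integral_max_sub_VaR h0 h1 hX, integral_max_sub_VaR h0 h1 hY, ← ha, ← hb] at h
  refine le_of_mul_le_mul_left ?_ (sub_pos.2 h1)
  linarith

end Quantile

theorem slideVaR_convex_riskTail
    {Ω : Type*} [MeasurableSpace Ω] (P : Measure Ω) [IsProbabilityMeasure P]
    (α β : ℝ) (hβ : 0 < β) (hβα : β ≤ α) (hα : α < 1) (φ : ℝ → ℝ)
    (hφ0 : ∀ p ∈ Set.Ico (0:ℝ) β, φ p = 0)
    (hφpos : ∀ p ∈ Set.Icc β 1, 0 ≤ φ p)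
    (hφmono : MonotoneOn φ (Set.Icc β 1))
    (hφnorm : ∫ p in (0:ℝ)..1, φ p = 1)
    (S : ℝ → ℝ) (hS : Monotone S) (hS01 : ∀ x, S x ∈ Set.Icc (0:ℝ) 1)
    (X Y : Ω → ℝ) (hX : Integrable X P) (hY : Integrable Y P)
    (hSX : S (tailThickness P φ X) = 1) (hSY : S (tailThickness P φ Y) = 1)
    (l : ℝ) (hl : l ∈ Set.Icc (0:ℝ) 1) :
    SlideVaR P α β φ S (fun ω => l * X ω + (1 - l) * Y ω)
      ≤ l * SlideVaR P α β φ S X + (1 - l) * SlideVaR P α β φ S Y := by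
  have h0 : 0 < α := hβ.trans_le hβα
  have hZ : Integrable (fun ω => l * X ω + (1 - l) * Y ω) P :=
    (hX.const_mul l).add (hY.const_mul (1 - l))
  have hVaR : VaR P β (fun ω => l * X ω + (1 - l) * Y ω)
      ≤ CVaR P α (fun ω => l * X ω + (1 - l) * Y ω) :=
    (monotoneOn_quantile hZ.aemeasurable ⟨hβ, hβα.trans_lt hα⟩ ⟨h0, hα⟩ hβα).trans
      (VaR_le_CVaR h0 hα hZ)
  have hconv := CVaR_convex h0 hα hX hY hl
  have hs := mul_le_mul_of_nonneg_left hVaR (sub_nonneg.2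
    (hS01 (tailThickness P φ (fun ω => l * X ω + (1 - l) * Y ω))).2)
  simp only [SlideVaR, hSX, hSY]
  linarith
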